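/- Every admissible τ-function of length N has at least two distinct admissible extensions to length N+1; consequently, for every N ≥ 1 the number of admissible τ-functions of length N is at least 2^{N−1}. -/

import Mathlib

open Function

/-- The order of `n` under `τ`: the least `m` with `τ^[m] n = 0` (junk value `0` if none). -/
noncomputable def ordOf (τ : ℕ → ℕ) (n : ℕ) : ℕ := sInf {m | τ^[m] n = 0}

/-- Property (A): `τ(1) = 0`. -/
def PropA (τ : ℕ → ℕ) : Prop := τ 1 = 0

/-- Property (B): `τ(n+1) ≤ τ(n) + 1` for all `1 ≤ n ≤ N - 1`. -/
def PropB (N : ℕ) (τ : ℕ → ℕ) : Prop :=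
  ∀ n, 1 ≤ n → n + 1 ≤ N → τ (n + 1) ≤ τ n + 1

/-- Property (C): if `τ(n+1) < τ^k(n) + 1` for some `0 < k < ord(n)`, then
`τ(n+1) ≤ τ^{k+1}(n) + 1`. -/
def PropC (N : ℕ) (τ : ℕ → ℕ) : Prop :=
  ∀ n, 1 ≤ n → n + 1 ≤ N → ∀ k, 0 < k → k < ordOf τ n →
    τ (n + 1) < τ^[k] n + 1 → τ (n + 1) ≤ τ^[k + 1] n + 1

/-- Property (D): if `τ(n+1) < τ^k(n) + 1` for some `0 < k < ord(n)`, and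
`τ(τ^k(n)+1) = τ^{k+1}(n)+1`, then `τ(n+1) < τ^{k+1}(n) + 1`. -/
def PropD (N : ℕ) (τ : ℕ → ℕ) : Prop :=
  ∀ n, 1 ≤ n → n + 1 ≤ N → ∀ k, 0 < k → k < ordOf τ n →
    τ (n + 1) < τ^[k] n + 1 → τ (τ^[k] n + 1) = τ^[k + 1] n + 1 →
      τ (n + 1) < τ^[k + 1] n + 1

/-- Property (E): if `ord(n) > 1` and `ord(τ^{ord(n)-1}(n) + 1) = 1`, then `τ(n+1) ≠ 0`. -/
def PropE (N : ℕ) (τ : ℕ → ℕ) : Prop :=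
  ∀ n, 1 ≤ n → n + 1 ≤ N → 1 < ordOf τ n →
    ordOf τ (τ^[ordOf τ n - 1] n + 1) = 1 → τ (n + 1) ≠ 0

/-- An admissible τ-function of length `N`, encoded as a function `ℕ → ℕ` with the
convention `τ 0 = 0`, satisfying properties (A)–(E) on the domain `{1, …, N}`. -/
def Admissible (N : ℕ) (τ : ℕ → ℕ) : Prop :=
  τ 0 = 0 ∧ PropA τ ∧ PropB N τ ∧ PropC N τ ∧ PropD N τ ∧ PropE N τ

/-- An admissible τ-function of length `N`, normalized to vanish outside `{1, …, N}`
so that τ-functions of length `N` correspond bijectively to such `ℕ → ℕ`. -/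
def TauFunction (N : ℕ) (τ : ℕ → ℕ) : Prop :=
  Admissible N τ ∧ ∀ n, N < n → τ n = 0

/-- `m` is a marker of a τ-function of length `N`: `m ∈ {1, …, N-1}` and
`τ(m+1) < τ(m) + 1`. -/
def IsMarker (N : ℕ) (τ : ℕ → ℕ) (m : ℕ) : Prop :=
  1 ≤ m ∧ m + 1 ≤ N ∧ τ (m + 1) < τ m + 1

/-- `m` is a marker of `τ` appearing in the orbit `N ↦ τ(N) ↦ τ²(N) ↦ ⋯`. -/
def IsMarkerInOrbit (N : ℕ) (τ : ℕ → ℕ) (m : ℕ) : Prop :=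
  IsMarker N τ m ∧ ∃ j, 1 ≤ j ∧ τ^[j] N = m

/-- `l` is a marked level of `τ`: `l = τ^n(m)` for some marker `m` and `n > 0`,
with `0` always marked. -/
def IsMarkedLevel (N : ℕ) (τ : ℕ → ℕ) (l : ℕ) : Prop :=
  l = 0 ∨ ∃ m, IsMarker N τ m ∧ ∃ j, 0 < j ∧ τ^[j] m = l

/-- A marked grid of size `N`: entries `M j k` for `j + k ≤ N` satisfying the
Branner–Hubbard tableau rules (M0)–(M4). -/
def MarkedGrid (N : ℕ) (M : ℕ → ℕ → Prop) : Prop :=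
  -- (M0)
  (∀ n, n ≤ N → M n 0 ∧ M 0 n) ∧
  -- (M1)
  (∀ j k, j + k ≤ N → M j k → ∀ l, l ≤ j → M l k) ∧
  -- (M2)
  (∀ j k, j + k ≤ N → M j k → ∀ i, i ≤ j → (M (j - i) (k + i) ↔ M (j - i) i)) ∧
  -- (M3)
  (∀ j k m, j + k < N → 1 ≤ m → m ≤ j → M j k → ¬ M (j + 1) k →
    (∀ i, 0 < i → i < m → ¬ M (j - i) i) → M (j - m + 1) m → ¬ M (j - m + 1) (k + m)) ∧
  -- (M4)
  (∀ j k, j + k < N → M j k → ¬ M 1 j → M (j + 1) k →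
    (∀ i, 0 < i → i < j → ¬ M (j - i) (k + i)) → ¬ M 1 (j + k))


lemma adm_lt {N : ℕ} {τ : ℕ → ℕ} (h : Admissible N τ) :
    ∀ n, 1 ≤ n → n ≤ N → τ n < n := by
  intro n h1
  induction n, h1 using Nat.le_induction with
  | base => intro _; have := h.2.1; unfold PropA at this; omega
  | succ n hn ih =>
    intro hN
    have := h.2.2.1 n hn hN
    have := ih (by omega)
    omega

lemma adm_le {N : ℕ} {τ : ℕ → ℕ} (h : Admissible N τ) (n : ℕ) (hn : n ≤ N) : τ n ≤ n := by
  rcases Nat.eq_zero_or_pos n with rfl | h0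
  · exact h.1.le
  · exact (adm_lt h n h0 hn).le

lemma iter_le {N : ℕ} {τ : ℕ → ℕ} (h : Admissible N τ) (n : ℕ) (hn : n ≤ N) (k : ℕ) :
    τ^[k] n ≤ n := by
  induction k with
  | zero => simp
  | succ k ih =>
    rw [iterate_succ_apply']
    have := adm_le h (τ^[k] n) (by omega)
    omega

lemma iter_le_sub {N : ℕ} {τ : ℕ → ℕ} (h : Admissible N τ) (n : ℕ) (hn : n ≤ N) (k : ℕ) :
    τ^[k] n ≤ n - k := by
  induction k with
  | zero => simp
  | succ k ih =>
    rw [iterate_succ_apply']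
    rcases Nat.eq_zero_or_pos (τ^[k] n) with h0 | h0
    · rw [h0, h.1]; omega
    · have := adm_lt h (τ^[k] n) h0 (by omega)
      omega

lemma ord_spec {N : ℕ} {τ : ℕ → ℕ} (h : Admissible N τ) (n : ℕ) (hn : n ≤ N) :
    τ^[ordOf τ n] n = 0 := by
  have : (sInf {m | τ^[m] n = 0}) ∈ {m | τ^[m] n = 0} :=
    Nat.sInf_mem ⟨n, by have := iter_le_sub h n hn n; simp at this; exact this⟩
  exact this

lemma ord_lt {τ : ℕ → ℕ} {n k : ℕ} (hk : k < ordOf τ n) : 0 < τ^[k] n :=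
  Nat.pos_of_ne_zero (fun h0 => Nat.notMem_of_lt_sInf hk h0)

lemma iter_anti {N : ℕ} {τ : ℕ → ℕ} (h : Admissible N τ) (n : ℕ) (hn : n ≤ N) {a b : ℕ}
    (hab : a ≤ b) : τ^[b] n ≤ τ^[a] n := by
  obtain ⟨c, rfl⟩ := Nat.exists_eq_add_of_le hab
  rw [Nat.add_comm, iterate_add_apply]
  exact iter_le h _ ((iter_le h n hn a).trans hn) c

lemma iter_strict {N : ℕ} {τ : ℕ → ℕ} (h : Admissible N τ) (n : ℕ) (hn : n ≤ N) {a b : ℕ}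
    (hab : a < b) (ha : a < ordOf τ n) : τ^[b] n < τ^[a] n := by
  have h1 : τ^[b] n ≤ τ^[a+1] n := iter_anti h n hn hab
  rw [iterate_succ_apply'] at h1
  have := adm_lt h (τ^[a] n) (ord_lt ha) ((iter_le h n hn a).trans hn)
  omega

lemma iter_congr {N : ℕ} {τ σ : ℕ → ℕ} (h : Admissible N τ) (hs : ∀ n, n ≤ N → σ n = τ n)
    (n : ℕ) (hn : n ≤ N) (k : ℕ) : σ^[k] n = τ^[k] n := by
  induction k with
  | zero => rfl
  | succ k ih =>
    rw [iterate_succ_apply', iterate_succ_apply', ih]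
    exact hs _ ((iter_le h n hn k).trans hn)

lemma ord_congr {N : ℕ} {τ σ : ℕ → ℕ} (h : Admissible N τ) (hs : ∀ n, n ≤ N → σ n = τ n)
    (n : ℕ) (hn : n ≤ N) : ordOf σ n = ordOf τ n := by
  unfold ordOf
  simp only [iter_congr h hs n hn]

lemma ext_adm {N : ℕ} {τ : ℕ → ℕ} (hN : 1 ≤ N) (h : TauFunction N τ) (x : ℕ)
    (hB : x ≤ τ N + 1)
    (hC : ∀ k, 0 < k → k < ordOf τ N → x < τ^[k] N + 1 → x ≤ τ^[k + 1] N + 1)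
    (hD : ∀ k, 0 < k → k < ordOf τ N → x < τ^[k] N + 1 → τ (τ^[k] N + 1) = τ^[k + 1] N + 1 →
      x < τ^[k + 1] N + 1)
    (hE : 1 < ordOf τ N → ordOf τ (τ^[ordOf τ N - 1] N + 1) = 1 → x ≠ 0) :
    TauFunction (N + 1) (update τ (N + 1) x) ∧
      ∀ n, 1 ≤ n → n ≤ N → update τ (N + 1) x n = τ n := by
  obtain ⟨ha, hz⟩ := h
  have hs : ∀ n, n ≤ N → update τ (N + 1) x n = τ n := fun n hn =>
    update_of_ne (by omega) _ _
  have hx : update τ (N + 1) x (N + 1) = x := update_self _ _ _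
  have hi := iter_congr ha hs
  have ho := ord_congr ha hs
  have hlt : ∀ n k, 1 ≤ n → n ≤ N → 0 < k → τ^[k] n + 1 ≤ N := by
    intro n k h1 h2 h3
    have := iter_le_sub ha n h2 k
    omega
  have hz' : ∀ n, N + 1 < n → update τ (N + 1) x n = 0 := fun n hn => by
    rw [update_of_ne (by omega)]; exact hz n (by omega)
  generalize update τ (N + 1) x = σ at *
  refine ⟨⟨⟨?_, ?_, ?_, ?_, ?_, ?_⟩, hz'⟩, fun n _ hn => hs n hn⟩
  · rw [hs 0 (by omega)]; exact ha.1
  · unfold PropA; rw [hs 1 hN]; exact ha.2.1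
  · intro n h1 h2
    rcases Nat.lt_or_eq_of_le (Nat.le_of_succ_le_succ h2) with h3 | rfl
    · rw [hs n (by omega), hs (n+1) (by omega)]; exact ha.2.2.1 n h1 (by omega)
    · rw [hx, hs n le_rfl]; exact hB
  · intro n h1 h2 k hk
    rw [ho n (by omega), hi n (by omega), hi n (by omega)]
    rcases Nat.lt_or_eq_of_le (Nat.le_of_succ_le_succ h2) with h3 | rfl
    · rw [hs (n+1) (by omega)]; exact ha.2.2.2.1 n h1 (by omega) k hk
    · rw [hx]; exact hC k hk
  · intro n h1 h2 k hk
    rw [ho n (by omega), hi n (by omega), hi n (by omega), hs _ (hlt n k h1 (by omega) hk)]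
    rcases Nat.lt_or_eq_of_le (Nat.le_of_succ_le_succ h2) with h3 | rfl
    · rw [hs (n+1) (by omega)]; exact ha.2.2.2.2.1 n h1 (by omega) k hk
    · rw [hx]; exact hD k hk
  · intro n h1 h2
    rw [ho n (by omega), hi n (by omega)]
    intro h4
    rw [ho _ (hlt n _ h1 (by omega) (by omega))]
    revert h4
    rcases Nat.lt_or_eq_of_le (Nat.le_of_succ_le_succ h2) with h3 | rfl
    · rw [hs (n+1) (by omega)]; exact ha.2.2.2.2.2 n h1 (by omega)
    · rw [hx]; exact hE

lemma two_ext (N : ℕ) (hN : 1 ≤ N) (τ : ℕ → ℕ) (h : TauFunction N τ) :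
      ∃ τ₁ τ₂ : ℕ → ℕ, τ₁ ≠ τ₂ ∧
        (TauFunction (N + 1) τ₁ ∧ ∀ n, 1 ≤ n → n ≤ N → τ₁ n = τ n) ∧
        (TauFunction (N + 1) τ₂ ∧ ∀ n, 1 ≤ n → n ≤ N → τ₂ n = τ n) := by
  have ha := h.1
  have key : ∃ x, x ≠ τ N + 1 ∧ (TauFunction (N + 1) (update τ (N + 1) x) ∧
      ∀ n, 1 ≤ n → n ≤ N → update τ (N + 1) x n = τ n) := by
    by_cases hc : ∃ k, 0 < k ∧ k < ordOf τ N ∧ τ (τ^[k] N + 1) ≠ τ^[k + 1] N + 1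
    · obtain ⟨k, hk, hko, hne⟩ := hc
      have h1 : τ^[k+1] N < τ N :=
        iter_strict ha N le_rfl (a := 1) (by omega) (by omega)
      have hj : ∀ j, τ^[k+1] N + 1 < τ^[j] N + 1 → j ≤ k := by
        intro j hj
        by_contra hcon
        have := iter_anti ha N le_rfl (a := k+1) (b := j) (by omega)
        omega
      refine ⟨τ^[k+1] N + 1, by omega, ext_adm hN h _ (by omega) ?_ ?_ (by simp)⟩
      · intro j _ _ hlt
        have := hj j hlt
        have := iter_anti ha N le_rfl (a := j+1) (b := k+1) (by omega)
        omega
      · intro j _ hjo hlt he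
        have h2 := hj j hlt
        rcases Nat.lt_or_eq_of_le h2 with h3 | rfl
        · have := iter_strict ha N le_rfl (a := j+1) (b := k+1) (by omega) (by omega)
          omega
        · exact absurd he hne
    · push Not at hc
      refine ⟨0, by omega, ext_adm hN h 0 (by omega) (by simp) (by simp) ?_⟩
      intro ho he
      exfalso
      have h1 := hc (ordOf τ N - 1) (by omega) (by omega)
      rw [Nat.sub_add_cancel (by omega), ord_spec ha N le_rfl] at h1
      have hle : τ^[ordOf τ N - 1] N + 1 ≤ N := by
        have := iter_le_sub ha N le_rfl (ordOf τ N - 1)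
        omega
      have h2 := ord_spec ha _ hle
      rw [he] at h2
      simp at h2
      omega
  obtain ⟨x, hx, h2⟩ := key
  refine ⟨_, _, ?_, h2, ext_adm hN h (τ N + 1) le_rfl ?_ ?_ (by simp)⟩
  · intro he
    have := congrFun he (N+1)
    simp at this
    exact hx this
  · intro k hk _ hlt
    have := iter_anti ha N le_rfl (a := 1) (b := k) hk
    simp only [iterate_one] at this
    omega
  · intro k hk _ hlt
    have := iter_anti ha N le_rfl (a := 1) (b := k) hk
    simp only [iterate_one] at this
    omega

lemma tau_finite (N : ℕ) : Finite {τ : ℕ → ℕ // TauFunction N τ} := by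
  let f : {τ : ℕ → ℕ // TauFunction N τ} → (Fin (N+1) → Fin (N+1)) := fun t i =>
    ⟨t.1 i, by have := adm_le t.2.1 i (by omega); omega⟩
  refine Finite.of_injective f ?_
  intro s t hst
  apply Subtype.ext
  funext n
  rcases Nat.lt_or_ge N n with h | h
  · rw [s.2.2 n h, t.2.2 n h]
  · have := congrFun hst ⟨n, by omega⟩
    simpa [f] using this

lemma card_bound (N : ℕ) (hN : 1 ≤ N) :
    2 ^ (N - 1) ≤ Nat.card {τ : ℕ → ℕ // TauFunction N τ} := by
  induction N, hN using Nat.le_induction with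
  | base =>
    have := tau_finite 1
    have : Nonempty {τ : ℕ → ℕ // TauFunction 1 τ} :=
      ⟨⟨fun _ => 0, ⟨rfl, rfl, fun n _ _ => by omega, fun n _ _ => by omega,
        fun n _ _ => by omega, fun n _ _ => by omega⟩, fun _ _ => rfl⟩⟩
    exact Nat.card_pos (α := {τ : ℕ → ℕ // TauFunction 1 τ})
  | succ N hN ih =>
    have := tau_finite N
    have := tau_finite (N+1)
    choose f g hne hf hg using two_ext N hN
    let F : {τ : ℕ → ℕ // TauFunction N τ} × Bool → {τ : ℕ → ℕ // TauFunction (N+1) τ} :=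
      fun p => if p.2 then ⟨f p.1.1 p.1.2, (hf _ _).1⟩ else ⟨g p.1.1 p.1.2, (hg _ _).1⟩
    have hF : ∀ p, ∀ n, 1 ≤ n → n ≤ N → (F p).1 n = p.1.1 n := by
      rintro ⟨t, b⟩ n h1 h2
      cases b
      · exact (hg t.1 t.2).2 n h1 h2
      · exact (hf t.1 t.2).2 n h1 h2
    have hinj : Injective F := by
      rintro ⟨s, b⟩ ⟨t, c⟩ h
      have hst : s = t := by
        apply Subtype.ext
        funext n
        rcases Nat.lt_or_ge N n with h' | h'
        · rw [s.2.2 n h', t.2.2 n h']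
        · rcases Nat.eq_zero_or_pos n with rfl | h0
          · rw [s.2.1.1, t.2.1.1]
          · have h3 := hF (s, b) n h0 h'
            rw [h, hF (t, c) n h0 h'] at h3
            exact h3.symm
      subst hst
      have h4 := congrArg Subtype.val h
      cases b <;> cases c
      · rfl
      · exact absurd h4.symm (hne s.1 s.2)
      · exact absurd h4 (hne s.1 s.2)
      · rfl
    have h5 := Nat.card_le_card_of_injective F hinj
    rw [Nat.card_prod, Nat.card_eq_fintype_card (α := Bool), Fintype.card_bool] at h5
    have : 2 ^ (N + 1 - 1) = 2 ^ (N - 1) * 2 := by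
      rw [← pow_succ]; congr 1; omega
    omega

/-- every admissible τ-function of length `N` has at least two distinct
admissible extensions to length `N + 1`; consequently, for every `N ≥ 1` there are at
least `2^(N-1)` admissible τ-functions of length `N`. -/
theorem two_extensions_and_lower_bound :
    (∀ N : ℕ, 1 ≤ N → ∀ τ : ℕ → ℕ, TauFunction N τ →
      ∃ τ₁ τ₂ : ℕ → ℕ, τ₁ ≠ τ₂ ∧
        (TauFunction (N + 1) τ₁ ∧ ∀ n, 1 ≤ n → n ≤ N → τ₁ n = τ n) ∧
        (TauFunction (N + 1) τ₂ ∧ ∀ n, 1 ≤ n → n ≤ N → τ₂ n = τ n)) ∧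
    (∀ N : ℕ, 1 ≤ N →
      2 ^ (N - 1) ≤ Nat.card {τ : ℕ → ℕ // TauFunction N τ}) := by
  exact ⟨two_ext, card_bound⟩
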